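/- Let M_n, M be random positive semidefinite matrices with M_n converging in distribution to M. Suppose there exist sets 𝓜_n, 𝓜 with P(M_n ∈ 𝓜_n) = P(M ∈ 𝓜) = 1 such that every deterministic sequence v_n → v with v_n ∈ 𝓜_n and v ∈ 𝓜 satisfies rank(v_n) = rank(v) for all sufficiently large n. Then the Moore–Penrose pseudoinverses converge in distribution: M_n⁺ →_d M⁺. -/

import Mathlib

open MeasureTheory Filter Matrix

attribute [local instance] Classical.propDecidable

/-- Matrices inherit the product measurable structure of functions. -/
instance matrixMeasurableSpace {m n α : Type*} [MeasurableSpace α] :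
    MeasurableSpace (Matrix m n α) :=
  inferInstanceAs (MeasurableSpace (m → n → α))

/-- The Moore–Penrose pseudoinverse of a real square matrix, defined via the four Penrose
equations (which determine it uniquely when a solution exists). -/
noncomputable def moorePenrose {K : ℕ} (A : Matrix (Fin K) (Fin K) ℝ) :
    Matrix (Fin K) (Fin K) ℝ :=
  if h : ∃ B, A * B * A = A ∧ B * A * B = B ∧ (A * B)ᵀ = A * B ∧ (B * A)ᵀ = B * A then
    h.choose
  else 0


theorem penrose_unique {K : ℕ} {A B C : Matrix (Fin K) (Fin K) ℝ}
    (b1 : A * B * A = A) (b2 : B * A * B = B) (b3 : (A * B)ᵀ = A * B) (b4 : (B * A)ᵀ = B * A)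
    (c1 : A * C * A = A) (c2 : C * A * C = C) (c3 : (A * C)ᵀ = A * C) (c4 : (C * A)ᵀ = C * A) :
    B = C := by
  have e1 : A * B = A * C := by
    calc A * B = (A * C) * (A * B) := by rw [← Matrix.mul_assoc, c1]
      _ = ((A * B) * (A * C))ᵀ := by rw [Matrix.transpose_mul, b3, c3]
      _ = A * C := by rw [← Matrix.mul_assoc, b1, c3]
  have e2 : B * A = C * A := by
    calc B * A = (B * A) * (C * A) := by rw [Matrix.mul_assoc, ← Matrix.mul_assoc A, c1]
      _ = ((C * A) * (B * A))ᵀ := by rw [Matrix.transpose_mul, b4, c4]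
      _ = C * A := by rw [Matrix.mul_assoc, ← Matrix.mul_assoc A, b1, c4]
  calc B = B * A * B := b2.symm
    _ = C * A * C := by rw [e2, Matrix.mul_assoc, e1, Matrix.mul_assoc]
    _ = C := c2

theorem moorePenrose_eq {K : ℕ} {A B : Matrix (Fin K) (Fin K) ℝ}
    (b1 : A * B * A = A) (b2 : B * A * B = B) (b3 : (A * B)ᵀ = A * B) (b4 : (B * A)ᵀ = B * A) :
    moorePenrose A = B := by
  have h : ∃ B, A * B * A = A ∧ B * A * B = B ∧ (A * B)ᵀ = A * B ∧ (B * A)ᵀ = B * A :=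
    ⟨B, b1, b2, b3, b4⟩
  rw [moorePenrose, dif_pos h]
  obtain ⟨c1, c2, c3, c4⟩ := h.choose_spec
  exact penrose_unique c1 c2 c3 c4 b1 b2 b3 b4

/-- a commuting symmetric generalized inverse, from the characteristic polynomial -/
noncomputable def ginv {K : ℕ} (k : ℕ) (A : Matrix (Fin K) (Fin K) ℝ) :
    Matrix (Fin K) (Fin K) ℝ :=
  (-(A.charpoly.coeff k)⁻¹) • ∑ i ∈ Finset.range K, A.charpoly.coeff (k + 1 + i) • A ^ i

/-- trailing degree of the characteristic polynomial -/
noncomputable def tdeg {K : ℕ} (A : Matrix (Fin K) (Fin K) ℝ) : ℕ := A.charpoly.natTrailingDegree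

theorem ker_sq {K : ℕ} {A : Matrix (Fin K) (Fin K) ℝ} (hA : Aᵀ = A) (k : ℕ)
    (Y : Matrix (Fin K) (Fin K) ℝ) (h : A ^ k * Y = 0) : A * Y = 0 := by
  induction k with
  | zero => simp at h; simp [h]
  | succ k ih =>
    rcases k with _ | k
    · simpa using h
    · apply ih
      have : (A ^ (k+1) * Y)ᴴ * (A ^ (k+1) * Y) = 0 := by
        rw [Matrix.conjTranspose_eq_transpose_of_trivial, Matrix.transpose_mul,
          Matrix.transpose_pow, hA, Matrix.mul_assoc, ← Matrix.mul_assoc (A ^ (k+1)), ← pow_add,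
          show k + 1 + (k + 1) = k + (k + 1 + 1) by ring, pow_add, Matrix.mul_assoc (A ^ k), h]
        simp
      exact Matrix.conjTranspose_mul_self_eq_zero.mp this

theorem ginv_spec {K : ℕ} {A : Matrix (Fin K) (Fin K) ℝ} (hA : Aᵀ = A) :
    A * ginv (tdeg A) A * A = A := by
  set k := tdeg A with hk
  set p := A.charpoly with hp
  have hp0 : p ≠ 0 := (Matrix.charpoly_monic A).ne_zero
  have hc : p.coeff k ≠ 0 := Polynomial.coeff_natTrailingDegree_ne_zero.mpr hp0
  set S := ∑ i ∈ Finset.range K, p.coeff (k + 1 + i) • A ^ i with hS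
  have hCH : Polynomial.aeval A p = 0 := Matrix.aeval_self_charpoly A
  have hdeg : p.natDegree < k + (K + 1) := by
    rw [hp, Matrix.charpoly_natDegree_eq_dim]; simp; omega
  have h1 : A ^ k * (p.coeff k • 1 + A * S) = 0 := by
    rw [Polynomial.aeval_eq_sum_range' hdeg, Finset.sum_range_add] at hCH
    rw [Finset.sum_eq_zero (s := Finset.range k), zero_add, Finset.sum_range_succ'] at hCH
    · rw [← hCH, hS, Finset.mul_sum, mul_add, Finset.mul_sum, add_comm]
      congr 1
      · refine Finset.sum_congr rfl fun i _ => ?_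
        rw [Matrix.mul_smul, Matrix.mul_smul, ← pow_succ', ← pow_add]
        congr 2; ring
      · simp
    · intro i hi
      rw [Polynomial.coeff_eq_zero_of_lt_natTrailingDegree (Finset.mem_range.mp hi), zero_smul]
  have h2 := ker_sq hA k _ h1
  have hcomm : A * S = S * A := by
    rw [hS, Finset.mul_sum, Finset.sum_mul]
    refine Finset.sum_congr rfl fun i _ => ?_
    rw [Matrix.mul_smul, Matrix.smul_mul, ← pow_succ, ← pow_succ']
  have h3 : A * S * A = -(p.coeff k) • A := by
    rw [mul_add, Matrix.mul_smul, mul_one, hcomm, ← Matrix.mul_assoc] at h2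
    rw [neg_smul]; exact eq_neg_of_add_eq_zero_right h2
  show A * ((-(p.coeff k)⁻¹) • S) * A = A
  rw [Matrix.mul_smul, Matrix.smul_mul, h3, smul_smul]
  simp [hc]

theorem ginv_comm {K : ℕ} (k : ℕ) (A : Matrix (Fin K) (Fin K) ℝ) :
    A * ginv k A = ginv k A * A := by
  rw [ginv, Matrix.mul_smul, Matrix.smul_mul, Finset.mul_sum, Finset.sum_mul]
  congr 1
  refine Finset.sum_congr rfl fun i _ => ?_
  rw [Matrix.mul_smul, Matrix.smul_mul, ← pow_succ, ← pow_succ']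

theorem ginv_symm {K : ℕ} (k : ℕ) {A : Matrix (Fin K) (Fin K) ℝ} (hA : Aᵀ = A) :
    (ginv k A)ᵀ = ginv k A := by
  simp [ginv, Matrix.transpose_sum, Matrix.transpose_pow, hA]

theorem moorePenrose_formula {K : ℕ} {A : Matrix (Fin K) (Fin K) ℝ} (hA : Aᵀ = A) :
    moorePenrose A = ginv (tdeg A) A * A * ginv (tdeg A) A := by
  have h := ginv_spec hA
  have hc := ginv_comm (tdeg A) A
  have hs := ginv_symm (tdeg A) hA
  set G := ginv (tdeg A) A
  have e1 : A * (G * A * G) = A * G := by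
    rw [← Matrix.mul_assoc, ← Matrix.mul_assoc, h]
  have e2 : (G * A * G) * A = G * A := by
    rw [Matrix.mul_assoc, Matrix.mul_assoc, ← Matrix.mul_assoc A, h]
  apply moorePenrose_eq
  · rw [e1, h]
  · rw [e2, ← Matrix.mul_assoc, ← Matrix.mul_assoc, Matrix.mul_assoc G A G, Matrix.mul_assoc G,
      h, Matrix.mul_assoc]
  · rw [e1, Matrix.transpose_mul, hs, hA, hc]
  · rw [e2, Matrix.transpose_mul, hs, hA, hc]

theorem tdeg_rank {K : ℕ} {A : Matrix (Fin K) (Fin K) ℝ} (hA : Aᵀ = A) :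
    tdeg A + A.rank = K := by
  have hH : A.IsHermitian := by
    rw [Matrix.IsHermitian, Matrix.conjTranspose_eq_transpose_of_trivial, hA]
  have h1 : tdeg A = A.charpoly.rootMultiplicity 0 := by
    rw [tdeg, Polynomial.rootMultiplicity_eq_natTrailingDegree']
  rw [h1, ← Polynomial.count_roots, hH.roots_charpoly_eq_eigenvalues,
    hH.rank_eq_card_non_zero_eigs, Multiset.count_map, Fintype.card_subtype]
  have := Finset.card_filter_add_card_filter_not (s := (Finset.univ : Finset (Fin K)))
    (fun i => hH.eigenvalues i = 0)
  simp only [Finset.card_univ, Fintype.card_fin] at this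
  refine Eq.trans ?_ this
  congr 1
  · rw [Finset.card, Finset.filter_val]
    congr 1
    refine Multiset.filter_congr fun i _ => ?_
    simp [eq_comm]

theorem continuous_charpoly_coeff {K : ℕ} (k : ℕ) :
    Continuous fun A : Matrix (Fin K) (Fin K) ℝ => A.charpoly.coeff k := by
  have : (fun A : Matrix (Fin K) (Fin K) ℝ => A.charpoly.coeff k) = fun A =>
      MvPolynomial.eval (fun ij : Fin K × Fin K => A ij.1 ij.2)
        ((Matrix.charpoly.univ ℝ (Fin K)).coeff k) := by
    funext A
    exact (Matrix.charpoly.univ_coeff_eval₂Hom (Fin K) (RingHom.id ℝ)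
      (fun ij : Fin K × Fin K => A ij.1 ij.2) k).symm
  rw [this]
  refine (MvPolynomial.continuous_eval _).comp ?_
  fun_prop

instance matrixBorel (K : ℕ) : BorelSpace (Matrix (Fin K) (Fin K) ℝ) :=
  inferInstanceAs (BorelSpace (Fin K → Fin K → ℝ))

instance matrixSecondCountable (K : ℕ) : SecondCountableTopology (Matrix (Fin K) (Fin K) ℝ) :=
  inferInstanceAs (SecondCountableTopology (Fin K → Fin K → ℝ))

instance matrixMetrizable (K : ℕ) :
    TopologicalSpace.PseudoMetrizableSpace (Matrix (Fin K) (Fin K) ℝ) :=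
  inferInstanceAs (TopologicalSpace.PseudoMetrizableSpace (Fin K → Fin K → ℝ))

theorem measurable_tdeg {K : ℕ} : Measurable (tdeg : Matrix (Fin K) (Fin K) ℝ → ℕ) := by
  refine measurable_to_countable' fun k => ?_
  have : (tdeg : Matrix (Fin K) (Fin K) ℝ → ℕ) ⁻¹' {k} =
      {A | A.charpoly.coeff k ≠ 0} ∩ ⋂ j ∈ Finset.range k, {A | A.charpoly.coeff j = 0} := by
    ext A
    simp only [Set.mem_preimage, Set.mem_singleton_iff, Set.mem_inter_iff, Set.mem_ofPred_eq,
      Set.mem_iInter, Finset.mem_range]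
    have hp0 : A.charpoly ≠ 0 := (Matrix.charpoly_monic A).ne_zero
    constructor
    · rintro rfl
      exact ⟨Polynomial.coeff_natTrailingDegree_ne_zero.mpr hp0,
        fun j hj => Polynomial.coeff_eq_zero_of_lt_natTrailingDegree hj⟩
    · rintro ⟨h1, h2⟩
      refine le_antisymm (Polynomial.natTrailingDegree_le_of_ne_zero h1) ?_
      exact Polynomial.le_natTrailingDegree hp0 fun j hj => h2 j hj
  rw [this]
  refine MeasurableSet.inter ?_ (Finset.measurableSet_biInter _ fun j _ => ?_)
  · exact (isOpen_ne_fun (continuous_charpoly_coeff k) continuous_const).measurableSet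
  · exact (isClosed_eq (continuous_charpoly_coeff j) continuous_const).measurableSet

/-- the candidate formula on stratum `k` -/
noncomputable def strat {K : ℕ} (k : ℕ) (A : Matrix (Fin K) (Fin K) ℝ) :
    Matrix (Fin K) (Fin K) ℝ := ginv k A * A * ginv k A

theorem continuous_sumpart {K : ℕ} (k : ℕ) : Continuous fun A : Matrix (Fin K) (Fin K) ℝ =>
    ∑ i ∈ Finset.range K, A.charpoly.coeff (k + 1 + i) • A ^ i :=
  continuous_finsetSum _ fun i _ => (continuous_charpoly_coeff _).smul (continuous_id.pow i)

theorem continuousAt_strat {K : ℕ} (k : ℕ) {A : Matrix (Fin K) (Fin K) ℝ}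
    (h : A.charpoly.coeff k ≠ 0) : ContinuousAt (strat k) A := by
  have h1 : ContinuousAt (ginv k) A :=
    (((continuous_charpoly_coeff k).continuousAt.inv₀ h).neg).smul
      (continuous_sumpart k).continuousAt
  exact (h1.mul continuousAt_id).mul h1

theorem measurable_strat {K : ℕ} (k : ℕ) :
    Measurable (strat k : Matrix (Fin K) (Fin K) ℝ → _) := by
  have e : (strat k : Matrix (Fin K) (Fin K) ℝ → _) = fun A =>
      ((-(A.charpoly.coeff k)⁻¹) * (-(A.charpoly.coeff k)⁻¹)) •
      ((∑ i ∈ Finset.range K, A.charpoly.coeff (k + 1 + i) • A ^ i) * A *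
        (∑ i ∈ Finset.range K, A.charpoly.coeff (k + 1 + i) • A ^ i)) := by
    funext A
    simp only [strat, ginv, Matrix.smul_mul, Matrix.mul_smul, smul_smul]
  rw [e]
  have h1 : Measurable fun A : Matrix (Fin K) (Fin K) ℝ => -(A.charpoly.coeff k)⁻¹ :=
    (continuous_charpoly_coeff k).measurable.inv.neg
  have h2 : Continuous fun A : Matrix (Fin K) (Fin K) ℝ =>
    ((∑ i ∈ Finset.range K, A.charpoly.coeff (k + 1 + i) • A ^ i) * A *
        (∑ i ∈ Finset.range K, A.charpoly.coeff (k + 1 + i) • A ^ i)) :=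
    ((continuous_sumpart k).mul continuous_id).mul (continuous_sumpart k)
  exact (h1.mul h1).smul h2.measurable

/-- measurable version of the pseudoinverse -/
noncomputable def pin {K : ℕ} (A : Matrix (Fin K) (Fin K) ℝ) :
    Matrix (Fin K) (Fin K) ℝ := strat (tdeg A) A

theorem measurable_pin {K : ℕ} : Measurable (pin : Matrix (Fin K) (Fin K) ℝ → _) := by
  intro F hF
  have : (pin : Matrix (Fin K) (Fin K) ℝ → _) ⁻¹' F =
      ⋃ k : ℕ, (tdeg ⁻¹' {k}) ∩ (strat k ⁻¹' F) := by
    ext A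
    simp [pin]
  rw [this]
  exact MeasurableSet.iUnion fun k =>
    (measurable_tdeg (measurableSet_singleton k)).inter (measurable_strat k hF)

theorem continuousOn_pin {K : ℕ} (k : ℕ) :
    ContinuousOn (pin : Matrix (Fin K) (Fin K) ℝ → _) {A | tdeg A = k} := by
  have : ContinuousOn (strat k : Matrix (Fin K) (Fin K) ℝ → _) {A | tdeg A = k} := by
    rintro A rfl
    exact (continuousAt_strat _ (Polynomial.coeff_natTrailingDegree_ne_zero.mpr
      (Matrix.charpoly_monic A).ne_zero)).continuousWithinAt
  refine this.congr ?_
  rintro A rfl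
  rfl

open scoped Topology

theorem outer_full_null {Ω : Type*} [MeasurableSpace Ω] (P : Measure Ω) [IsProbabilityMeasure P]
    {B E : Set Ω} (hB : P B = 1) (hE : MeasurableSet E) (hd : ∀ ω ∈ E, ω ∉ B) : P E = 0 := by
  have h1 : B ⊆ Eᶜ := fun ω h1 h2 => hd ω h2 h1
  rw [← prob_compl_eq_one_iff hE]
  exact le_antisymm prob_le_one (hB ▸ measure_mono h1)

/-- sequential property to neighbourhood property -/
theorem seq_to_nhds {E : Type*} [TopologicalSpace E] [SecondCountableTopology E]
    (D : ℕ → Set E) (w : E) (Q : E → Prop)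
    (hne : ∀ n, (D n).Nonempty)
    (hnear : ∀ U ∈ 𝓝 w, ∀ᶠ n in atTop, (U ∩ D n).Nonempty)
    (hseq : ∀ v : ℕ → E, (∀ n, v n ∈ D n) → Tendsto v atTop (𝓝 w) → ∀ᶠ n in atTop, Q (v n)) :
    ∃ U ∈ 𝓝 w, ∃ N, ∀ n ≥ N, ∀ x ∈ U, x ∈ D n → Q x := by
  obtain ⟨b, hb⟩ := (𝓝 w).exists_antitone_basis
  by_contra! hcon
  -- approximating sequence
  obtain ⟨u, huD, hu⟩ : ∃ u : ℕ → E, (∀ n, u n ∈ D n) ∧ Tendsto u atTop (𝓝 w) := by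
    have hch : ∀ n, ∃ x ∈ D n, ∀ j ≤ n, (b j ∩ D n).Nonempty → x ∈ b j := by
      intro n
      by_cases hex : ∃ j ≤ n, (b j ∩ D n).Nonempty
      · let j0 := Nat.findGreatest (fun j => (b j ∩ D n).Nonempty) n
        obtain ⟨j, hj, hj'⟩ := hex
        have hj0 : (b j0 ∩ D n).Nonempty :=
          Nat.findGreatest_spec (P := fun j => (b j ∩ D n).Nonempty) hj hj'
        obtain ⟨x, hx, hxD⟩ := hj0
        refine ⟨x, hxD, fun i hi hi' => ?_⟩
        exact hb.antitone (Nat.le_findGreatest (P := fun j => (b j ∩ D n).Nonempty) hi hi') hx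
      · obtain ⟨x, hx⟩ := hne n
        exact ⟨x, hx, fun j hj hj' => absurd ⟨j, hj, hj'⟩ hex⟩
    choose u hu1 hu2 using hch
    refine ⟨u, hu1, hb.tendsto_right_iff.mpr fun j _ => ?_⟩
    filter_upwards [hnear (b j) (hb.mem j), eventually_ge_atTop j] with n hn hjn
    exact hu2 n j hjn hn
  -- bad subsequence
  have hbad : ∀ j N, ∃ n ≥ N, ∃ x ∈ b j, x ∈ D n ∧ ¬ Q x := fun j N => by
    obtain ⟨n, hn, x, hx⟩ := hcon (b j) (hb.mem j) N
    exact ⟨n, hn, x, hx⟩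
  choose m hm y hyb hyD hyQ using hbad
  let φ : ℕ → ℕ := fun j => Nat.rec (m 0 0) (fun j p => m (j+1) (p+1)) j
  have hφs : ∀ j, φ (j+1) = m (j+1) (φ j + 1) := fun j => rfl
  have hφ : StrictMono φ := strictMono_nat_of_lt_succ fun j => by
    rw [hφs]; exact hm (j+1) (φ j + 1)
  have hx : ∀ j, ∃ x ∈ b j, x ∈ D (φ j) ∧ ¬ Q x := by
    intro j
    cases j with
    | zero => exact ⟨y 0 0, hyb 0 0, hyD 0 0, hyQ 0 0⟩
    | succ j => exact ⟨y (j+1) (φ j + 1), hyb _ _, hyD _ _, hyQ _ _⟩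
  choose x hxb hxD hxQ using hx
  let v := Function.extend φ x u
  have hv : ∀ j, v (φ j) = x j := fun j => hφ.injective.extend_apply x u j
  have hv' : ∀ n, (¬ ∃ j, φ j = n) → v n = u n := fun n hn => Function.extend_apply' x u n hn
  have hvD : ∀ n, v n ∈ D n := by
    intro n
    rcases Classical.em (∃ j, φ j = n) with h | h
    · obtain ⟨j, rfl⟩ := h
      rw [hv]; exact hxD j
    · rw [hv' n h]; exact huD n
  have hvt : Tendsto v atTop (𝓝 w) := by
    refine hb.tendsto_right_iff.mpr fun i _ => ?_
    filter_upwards [hb.tendsto_right_iff.mp hu i trivial, eventually_ge_atTop (φ i)] with n h1 h2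
    rcases Classical.em (∃ j, φ j = n) with h | h
    · obtain ⟨j, rfl⟩ := h
      rw [hv]
      exact hb.antitone (hφ.le_iff_le.mp h2) (hxb j)
    · rw [hv' n h]; exact h1
  obtain ⟨N, hN⟩ := eventually_atTop.mp (hseq v hvD hvt)
  have := hN (φ N) (hφ.id_le N)
  rw [hv] at this
  exact hxQ N this

theorem ext_cmt {Ω E E' : Type*} [MeasurableSpace Ω] (P : Measure Ω) [IsProbabilityMeasure P]
    [TopologicalSpace E] [SecondCountableTopology E] [TopologicalSpace.PseudoMetrizableSpace E]
    [MeasurableSpace E] [BorelSpace E]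
    [TopologicalSpace E'] [TopologicalSpace.PseudoMetrizableSpace E']
    [MeasurableSpace E'] [BorelSpace E']
    (X : ℕ → Ω → E) (Y : Ω → E) (hX : ∀ n, Measurable (X n)) (hY : Measurable Y)
    (ρ : E → ℕ) (hρ : Measurable ρ) (g : E → E') (hg : Measurable g)
    (hgc : ∀ k, ContinuousOn g {x | ρ x = k})
    (D : ℕ → Set E) (D0 : Set E) (h1 : ∀ n, P {ω | X n ω ∈ D n} = 1) (h2 : P {ω | Y ω ∈ D0} = 1)
    (hseq : ∀ (v : ℕ → E) (w : E), (∀ n, v n ∈ D n) → w ∈ D0 → Tendsto v atTop (𝓝 w) →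
      ∀ᶠ n in atTop, ρ (v n) = ρ w)
    (hconv : ∀ f : BoundedContinuousFunction E ℝ,
      Tendsto (fun n => ∫ ω, f (X n ω) ∂P) atTop (𝓝 (∫ ω, f (Y ω) ∂P))) :
    ∀ f : BoundedContinuousFunction E' ℝ,
      Tendsto (fun n => ∫ ω, f (g (X n ω)) ∂P) atTop (𝓝 (∫ ω, f (g (Y ω)) ∂P)) := by
  let μs : ℕ → ProbabilityMeasure E := fun n =>
    ⟨P.map (X n), Measure.isProbabilityMeasure_map (hX n).aemeasurable⟩
  let μ : ProbabilityMeasure E := ⟨P.map Y, Measure.isProbabilityMeasure_map hY.aemeasurable⟩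
  have hμ : Tendsto μs atTop (𝓝 μ) := by
    rw [ProbabilityMeasure.tendsto_iff_forall_integral_tendsto]
    intro f
    have e1 : ∀ n, ∫ x, f x ∂(μs n : Measure E) = ∫ ω, f (X n ω) ∂P := fun n =>
      integral_map (hX n).aemeasurable f.continuous.measurable.aestronglyMeasurable
    have e2 : ∫ x, f x ∂(μ : Measure E) = ∫ ω, f (Y ω) ∂P :=
      integral_map hY.aemeasurable f.continuous.measurable.aestronglyMeasurable
    simp_rw [e1, e2]
    exact hconv f
  let νs : ℕ → ProbabilityMeasure E' := fun n =>
    ⟨P.map (fun ω => g (X n ω)),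
      Measure.isProbabilityMeasure_map (hg.comp (hX n)).aemeasurable⟩
  let ν : ProbabilityMeasure E' :=
    ⟨P.map (fun ω => g (Y ω)), Measure.isProbabilityMeasure_map (hg.comp hY).aemeasurable⟩
  suffices hν : Tendsto νs atTop (𝓝 ν) by
    rw [ProbabilityMeasure.tendsto_iff_forall_integral_tendsto] at hν
    intro f
    have e1 : ∀ n, ∫ x, f x ∂(νs n : Measure E') = ∫ ω, f (g (X n ω)) ∂P := fun n =>
      integral_map (hg.comp (hX n)).aemeasurable
        f.continuous.measurable.aestronglyMeasurable
    have e2 : ∫ x, f x ∂(ν : Measure E') = ∫ ω, f (g (Y ω)) ∂P :=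
      integral_map (hg.comp hY).aemeasurable f.continuous.measurable.aestronglyMeasurable
    have := hν f
    simp_rw [e1, e2] at this
    exact this
  -- neighbourhood claim
  have hDnull : ∀ n (A : Set E), MeasurableSet A → (∀ x ∈ A, x ∉ D n) →
      (μs n : Measure E) A = 0 := by
    intro n A hA hd
    show P.map (X n) A = 0
    rw [Measure.map_apply (hX n) hA]
    exact outer_full_null P (h1 n) (hX n hA) fun ω hω => hd _ hω
  have hD0null : ∀ (A : Set E), MeasurableSet A → (∀ x ∈ A, x ∉ D0) →
      (μ : Measure E) A = 0 := by
    intro A hA hd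
    show P.map Y A = 0
    rw [Measure.map_apply hY hA]
    exact outer_full_null P h2 (hY hA) fun ω hω => hd _ hω
  have hne : ∀ n, (D n).Nonempty := by
    intro n
    by_contra hcon
    have := hDnull n Set.univ MeasurableSet.univ fun x _ hx => hcon ⟨x, hx⟩
    simp at this
  have hclaim : ∀ w ∈ D0, w ∈ (μ : Measure E).support →
      ∃ U ∈ 𝓝 w, ∃ N, ∀ n ≥ N, ∀ x ∈ U, x ∈ D n → ρ x = ρ w := by
    intro w hw hws
    refine seq_to_nhds D w (fun x => ρ x = ρ w) hne ?_ fun v hv ht => hseq v w hv hw ht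
    intro U hU
    obtain ⟨V, hVU, hVo, hwV⟩ := mem_nhds_iff.mp hU
    have hpos : 0 < (μ : Measure E) V :=
      (Measure.mem_support_iff_forall w).mp hws V (hVo.mem_nhds hwV)
    have hli := ProbabilityMeasure.le_liminf_measure_open_of_tendsto hμ hVo
    have hev := eventually_lt_of_lt_liminf (lt_of_lt_of_le hpos hli)
    filter_upwards [hev] with n hn
    by_contra hcon
    refine hn.ne' (hDnull n V hVo.measurableSet fun x hx hxD => hcon ⟨x, hVU hx, hxD⟩)
  -- regularized sets
  let b := TopologicalSpace.countableBasis E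
  have hbB := TopologicalSpace.isBasis_countableBasis E
  have hbc : b.Countable := TopologicalSpace.countable_countableBasis E
  let Z : ℕ → Set E := fun n => {x | ∃ U ∈ b, ∃ r : ℕ, x ∈ U ∧ ρ x ≠ r ∧
    (μs n : Measure E) (U ∩ {x | ρ x ≠ r}) = 0}
  have hZ : ∀ n, (μs n : Measure E) (Z n) = 0 := by
    intro n
    have hsub : Z n ⊆ ⋃ U ∈ b, ⋃ r : ℕ, {x | x ∈ U ∧ ρ x ≠ r ∧
        (μs n : Measure E) (U ∩ {x | ρ x ≠ r}) = 0} := by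
      rintro x ⟨U, hU, r, hx⟩
      simp only [Set.mem_iUnion]
      exact ⟨U, hU, r, hx⟩
    refine measure_mono_null hsub ?_
    rw [measure_biUnion_null_iff hbc]
    intro U hU
    rw [measure_iUnion_null_iff]
    intro r
    by_cases h0 : (μs n : Measure E) (U ∩ {x | ρ x ≠ r}) = 0
    · exact measure_mono_null (t := U ∩ {x | ρ x ≠ r}) (fun x hx => And.intro hx.1 hx.2.1) h0
    · have : {x | x ∈ U ∧ ρ x ≠ r ∧ (μs n : Measure E) (U ∩ {x | ρ x ≠ r}) = 0} = ∅ := by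
        ext x; simp only [Set.mem_empty_iff_false, iff_false]; exact fun hx => h0 hx.2.2
      rw [this]; simp
  have hclaim2 : ∀ w ∈ D0, w ∈ (μ : Measure E).support →
      ∃ U ∈ 𝓝 w, ∃ N, ∀ n ≥ N, ∀ x ∈ U, x ∉ Z n → ρ x = ρ w := by
    intro w hw hws
    obtain ⟨U, hU, N, hN⟩ := hclaim w hw hws
    obtain ⟨V, hVb, hwV, hVU⟩ := hbB.mem_nhds_iff.mp hU
    refine ⟨V, (hbB.isOpen hVb).mem_nhds hwV, N, fun n hn x hx hxZ => ?_⟩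
    by_contra hne'
    refine hxZ ⟨V, hVb, ρ w, hx, hne', ?_⟩
    refine hDnull n _ ((hbB.isOpen hVb).measurableSet.inter
      (hρ (MeasurableSet.of_discrete (s := {ρ w}ᶜ)))) ?_
    rintro y ⟨hyV, hyr⟩ hyD
    exact hyr (hN n hn y (hVU hyV) hyD)
  refine tendsto_of_forall_isClosed_limsup_le' fun F hF => ?_
  have hνs : ∀ n, (νs n : Measure E') F = (μs n : Measure E) (g ⁻¹' F) := by
    intro n
    show P.map (fun ω => g (X n ω)) F = P.map (X n) (g ⁻¹' F)
    rw [Measure.map_apply (f := fun ω => g (X n ω)) (hg.comp (hX n)) hF.measurableSet,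
      Measure.map_apply (hX n) (hg hF.measurableSet)]
    rfl
  have hνe : (ν : Measure E') F = (μ : Measure E) (g ⁻¹' F) := by
    show P.map (fun ω => g (Y ω)) F = P.map Y (g ⁻¹' F)
    rw [Measure.map_apply (f := fun ω => g (Y ω)) (hg.comp hY) hF.measurableSet,
      Measure.map_apply hY (hg hF.measurableSet)]
    rfl
  simp_rw [hνs]
  rw [hνe]
  let C : ℕ → Set E := fun k => closure (⋃ m ≥ k, g ⁻¹' F \ Z m)
  have hCanti : Antitone C := by
    intro k l hkl
    refine closure_mono ?_
    refine Set.iUnion₂_subset fun m hm => ?_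
    exact Set.subset_iUnion₂_of_subset m (le_trans hkl hm) subset_rfl
  have hstep : ∀ k, limsup (fun n => (μs n : Measure E) (g ⁻¹' F)) atTop ≤
      (μ : Measure E) (C k) := by
    intro k
    refine le_trans (limsup_le_limsup ?_)
      (ProbabilityMeasure.limsup_measure_closed_le_of_tendsto hμ (isClosed_closure))
    filter_upwards [eventually_ge_atTop k] with n hn
    calc (μs n : Measure E) (g ⁻¹' F) = (μs n : Measure E) (g ⁻¹' F \ Z n) :=
          (measure_sdiff_null (hZ n)).symm
      _ ≤ _ := measure_mono fun x hx => subset_closure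
          (Set.mem_iUnion₂.mpr ⟨n, hn, hx⟩)
  have hlim : Tendsto (fun k => (μ : Measure E) (C k)) atTop
      (𝓝 ((μ : Measure E) (⋂ k, C k))) :=
    tendsto_measure_iInter_atTop (fun k => isClosed_closure.measurableSet.nullMeasurableSet)
      hCanti ⟨0, measure_ne_top _ _⟩
  refine (ge_of_tendsto' hlim hstep).trans ?_
  -- the intersection is a.e. contained in the preimage
  have hCm : MeasurableSet (⋂ k, C k) :=
    MeasurableSet.iInter fun k => isClosed_closure.measurableSet
  have hnull : (μ : Measure E) (((⋂ k, C k) \ g ⁻¹' F) ∩ (μ : Measure E).support) = 0 := by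
    refine hD0null _ ((hCm.diff (hg hF.measurableSet)).inter
      Measure.isClosed_support.measurableSet) ?_
    rintro w ⟨⟨hwC, hwF⟩, hws⟩ hw
    obtain ⟨U, hU, N, hN⟩ := hclaim2 w hw hws
    apply hwF
    have hcl : w ∈ closure ({x | ρ x = ρ w} ∩ g ⁻¹' F) := by
      rw [mem_closure_iff_nhds]
      intro V hV
      have hwN : w ∈ C N := Set.mem_iInter.mp hwC N
      obtain ⟨x, ⟨hxU, hxV⟩, hx⟩ := mem_closure_iff_nhds.mp hwN (U ∩ V) (inter_mem hU hV)
      simp only [Set.mem_iUnion] at hx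
      obtain ⟨m, hm, hxF, hxZ⟩ := hx
      exact ⟨x, hxV, hN m hm x hxU hxZ, hxF⟩
    have hcw : ContinuousWithinAt g ({x | ρ x = ρ w} ∩ g ⁻¹' F) w :=
      (hgc (ρ w) w rfl).mono Set.inter_subset_left
    have := hcw.mem_closure hcl (t := F) fun x hx => hx.2
    rwa [hF.closure_eq] at this
  have hsupp : (μ : Measure E) ((μ : Measure E).support)ᶜ = 0 := Measure.measure_compl_support
  have hsub : (⋂ k, C k) ⊆ g ⁻¹' F ∪ ((((⋂ k, C k) \ g ⁻¹' F) ∩ (μ : Measure E).support) ∪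
      ((μ : Measure E).support)ᶜ) := by
    intro x hx
    by_cases h1 : x ∈ g ⁻¹' F
    · exact Or.inl h1
    · by_cases h2 : x ∈ (μ : Measure E).support
      · exact Or.inr (Or.inl ⟨⟨hx, h1⟩, h2⟩)
      · exact Or.inr (Or.inr h2)
  refine (measure_mono hsub).trans ((measure_union_le _ _).trans ?_)
  rw [measure_union_null hnull hsupp, add_zero]

/-- if random PSD matrices `M_n →_d M` and there are full-measure sets
`𝓜_n, 𝓜` such that every convergent deterministic sequence `v_n → v` with `v_n ∈ 𝓜_n`,
`v ∈ 𝓜` has `rank v_n = rank v` eventually, then `M_n⁺ →_d M⁺` (convergence in distribution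
stated via bounded continuous test functions). -/
theorem pseudoinverse_weak_convergence
    {Ω : Type*} [MeasurableSpace Ω] (P : Measure Ω) [IsProbabilityMeasure P] {K : ℕ}
    (Mn : ℕ → Ω → Matrix (Fin K) (Fin K) ℝ) (M : Ω → Matrix (Fin K) (Fin K) ℝ)
    (hMnmeas : ∀ n, Measurable (Mn n)) (hMmeas : Measurable M)
    (hMnPSD : ∀ n, ∀ᵐ ω ∂P, (Mn n ω).PosSemidef)
    (hMPSD : ∀ᵐ ω ∂P, (M ω).PosSemidef)
    (𝓜n : ℕ → Set (Matrix (Fin K) (Fin K) ℝ)) (𝓜 : Set (Matrix (Fin K) (Fin K) ℝ))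
    (h1 : ∀ n, P {ω | Mn n ω ∈ 𝓜n n} = 1) (h2 : P {ω | M ω ∈ 𝓜} = 1)
    (hrank : ∀ (v : ℕ → Matrix (Fin K) (Fin K) ℝ) (w : Matrix (Fin K) (Fin K) ℝ),
      (∀ n, v n ∈ 𝓜n n) → w ∈ 𝓜 → Tendsto v atTop (nhds w) →
      ∀ᶠ n in atTop, (v n).rank = w.rank)
    (hconv : ∀ f : BoundedContinuousFunction (Matrix (Fin K) (Fin K) ℝ) ℝ,
      Tendsto (fun n => ∫ ω, f (Mn n ω) ∂P) atTop (nhds (∫ ω, f (M ω) ∂P))) :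
    ∀ f : BoundedContinuousFunction (Matrix (Fin K) (Fin K) ℝ) ℝ,
      Tendsto (fun n => ∫ ω, f (moorePenrose (Mn n ω)) ∂P) atTop
        (nhds (∫ ω, f (moorePenrose (M ω)) ∂P)) := by
  intro f
  have hsymm : ∀ A : Matrix (Fin K) (Fin K) ℝ, A.PosSemidef → Aᵀ = A := fun A hA => by
    rw [← Matrix.conjTranspose_eq_transpose_of_trivial]; exact hA.1
  have e : ∀ X : Ω → Matrix (Fin K) (Fin K) ℝ, (∀ᵐ ω ∂P, (X ω).PosSemidef) →
      ∫ ω, f (moorePenrose (X ω)) ∂P = ∫ ω, f (pin (X ω)) ∂P := by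
    intro X hX
    refine integral_congr_ae ?_
    filter_upwards [hX] with ω hω
    rw [moorePenrose_formula (hsymm _ hω), pin, strat]
  have hfull : ∀ (X : Ω → Matrix (Fin K) (Fin K) ℝ) (D : Set (Matrix (Fin K) (Fin K) ℝ)),
      (∀ᵐ ω ∂P, (X ω).PosSemidef) → P {ω | X ω ∈ D} = 1 →
      P {ω | X ω ∈ D ∩ {A | A.PosSemidef}} = 1 := by
    intro X D hX hD
    rw [← hD]
    refine measure_congr ?_
    filter_upwards [hX] with ω hω
    exact propext ⟨fun h => h.1, fun h => ⟨h, hω⟩⟩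
  simp_rw [fun n => e (Mn n) (hMnPSD n)]
  rw [e M hMPSD]
  refine ext_cmt P Mn M hMnmeas hMmeas tdeg measurable_tdeg pin measurable_pin continuousOn_pin
    (fun n => 𝓜n n ∩ {A | A.PosSemidef}) (𝓜 ∩ {A | A.PosSemidef})
    (fun n => hfull _ _ (hMnPSD n) (h1 n)) (hfull _ _ hMPSD h2) ?_ hconv f
  intro v w hv hw ht
  filter_upwards [hrank v w (fun n => (hv n).1) hw.1 ht] with n hn
  have a1 := tdeg_rank (hsymm _ (hv n).2)
  have a2 := tdeg_rank (hsymm _ hw.2)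
  omega
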